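/- Let 0 < v_min ≤ v_max, 0 < μ_min ≤ μ_max, and for parameters v ∈ [v_min, v_max] and μ ∈ [μ_min, μ_max] define the function g_{v,μ}(ρ) = μ(1 − e^{−(v/μ)ρ}) on [0,∞). Then there exists a constant C > 0, depending only on v_min, v_max, μ_min, μ_max, such that for all v_1, v_2 ∈ [v_min, v_max] and μ_1, μ_2 ∈ [μ_min, μ_max]: ‖g_{v_1,μ_1} − g_{v_2,μ_2}‖_{C^{0,1}([0,∞))} ≤ C (|v_1 − v_2| + |v_1/μ_1 − v_2/μ_2|), where ‖g‖_{C^{0,1}([0,∞))} := sup_{ρ ≥ 0} |g(ρ)| + sup_{ρ≠σ, ρ,σ ≥ 0} |g(ρ) − g(σ)|/|ρ − σ|. -/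

import Mathlib

open Set

/-- The `C^{0,1}`-norm of a function `g` restricted to `[0,∞)`:
sup-norm plus optimal Lipschitz constant on `[0,∞)`. -/
noncomputable def holNormIci (g : ℝ → ℝ) : ℝ :=
  (⨆ ρ : Ici (0:ℝ), |g ρ|) +
    ⨆ p : {q : Ici (0:ℝ) × Ici (0:ℝ) // (q.1 : ℝ) ≠ (q.2 : ℝ)},
      |g (p.1.1 : ℝ) - g (p.1.2 : ℝ)| / |(p.1.1 : ℝ) - (p.1.2 : ℝ)|

lemma exp_diff_aux (m a b ρ : ℝ) (hm : 0 < m) (ha : m ≤ a) (hb : m ≤ b) (hρ : 0 ≤ ρ) :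
    |Real.exp (-a * ρ) - Real.exp (-b * ρ)| ≤ |a - b| / m := by
  wlog hab : a ≤ b generalizing a b
  · rw [abs_sub_comm, abs_sub_comm a b]
    exact this b a hb ha (le_of_not_ge hab)
  have h1 : Real.exp (-b * ρ) = Real.exp (-a * ρ) * Real.exp (-((b - a) * ρ)) := by
    rw [← Real.exp_add]; congr 1; ring
  have h2 : 1 - (b - a) * ρ ≤ Real.exp (-((b - a) * ρ)) := by
    have := Real.add_one_le_exp (-((b - a) * ρ)); linarith
  have h3 : Real.exp (-((b - a) * ρ)) ≤ 1 := by
    rw [Real.exp_le_one_iff]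
    have := mul_nonneg (sub_nonneg.2 hab) hρ; linarith
  have hE := Real.exp_pos (-a * ρ)
  have h4 : Real.exp (-a * ρ) * (m * ρ) ≤ 1 := by
    have h5 : m * ρ ≤ Real.exp (a * ρ) := by
      have := Real.add_one_le_exp (a * ρ)
      have := mul_le_mul_of_nonneg_right ha hρ
      linarith
    calc Real.exp (-a * ρ) * (m * ρ) ≤ Real.exp (-a * ρ) * Real.exp (a * ρ) := by gcongr
      _ = 1 := by rw [← Real.exp_add]; simp
  rw [h1, abs_of_nonneg (by nlinarith), abs_of_nonpos (by linarith), le_div_iff₀ hm]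
  have h6 : Real.exp (-a * ρ) * (1 - Real.exp (-((b - a) * ρ))) * m
      ≤ Real.exp (-a * ρ) * ((b - a) * ρ) * m := by
    gcongr; linarith
  have h7 := mul_le_mul_of_nonneg_left h4 (sub_nonneg.2 hab)
  linarith

/-- For the production fluxes `g_{v,μ}(ρ) = μ(1 − e^{−(v/μ)ρ})` with parameters in compact
boxes away from `0`, one has
`‖g_{v₁,μ₁} − g_{v₂,μ₂}‖_{C^{0,1}([0,∞))} ≤ C(|v₁ − v₂| + |v₁/μ₁ − v₂/μ₂|)`. -/
theorem production_flux_parameter_estimate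
    (vmin vmax μmin μmax : ℝ)
    (hvmin : 0 < vmin) (hvle : vmin ≤ vmax)
    (hμmin : 0 < μmin) (hμle : μmin ≤ μmax) :
    ∃ C > (0:ℝ), ∀ v₁ ∈ Icc vmin vmax, ∀ v₂ ∈ Icc vmin vmax,
      ∀ μ₁ ∈ Icc μmin μmax, ∀ μ₂ ∈ Icc μmin μmax,
        holNormIci (fun ρ => μ₁ * (1 - Real.exp (-(v₁ / μ₁) * ρ)) -
            μ₂ * (1 - Real.exp (-(v₂ / μ₂) * ρ))) ≤
          C * (|v₁ - v₂| + |v₁ / μ₁ - v₂ / μ₂|) := by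
  set m := vmin / μmax with hmdef
  have hμmax : 0 < μmax := by linarith
  have hvmax : 0 < vmax := by linarith
  have hm : 0 < m := by positivity
  refine ⟨(1 / m + 2 * μmax / m) + (1 + vmax / m), by positivity, ?_⟩
  rintro v₁ ⟨hv1, hv1'⟩ v₂ ⟨hv2, hv2'⟩ μ₁ ⟨hμ1, hμ1'⟩ μ₂ ⟨hμ2, hμ2'⟩
  have hp1 : 0 < μ₁ := by linarith
  have hp2 : 0 < μ₂ := by linarith
  have hw1 : 0 < v₁ := by linarith
  have hw2 : 0 < v₂ := by linarith
  have ha : m ≤ v₁ / μ₁ := by rw [hmdef]; gcongr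
  have hb : m ≤ v₂ / μ₂ := by rw [hmdef]; gcongr
  have e1 : v₁ = μ₁ * (v₁ / μ₁) := by field_simp
  have e2 : v₂ = μ₂ * (v₂ / μ₂) := by field_simp
  generalize v₁ / μ₁ = a at *
  generalize v₂ / μ₂ = b at *
  have hA := abs_nonneg (v₁ - v₂)
  have hB := abs_nonneg (a - b)
  have key := fun ρ hρ => exp_diff_aux m a b ρ hm ha hb hρ
  have hμ : |μ₁ - μ₂| ≤ |v₁ - v₂| / m + μmax * (|a - b| / m) := by
    have h1 : |μ₁ - μ₂| * a ≤ |v₁ - v₂| + μmax * |a - b| := by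
      have : (μ₁ - μ₂) * a = (v₁ - v₂) - μ₂ * (a - b) := by rw [e1, e2]; ring
      rw [← abs_of_pos (hm.trans_le ha), ← abs_mul, abs_of_pos (hm.trans_le ha), this]
      refine (abs_sub _ _).trans ?_
      rw [abs_mul, abs_of_pos hp2]
      gcongr
    have h2 : |μ₁ - μ₂| * m ≤ |μ₁ - μ₂| * a := by gcongr
    rw [← mul_div_assoc, ← add_div, le_div_iff₀ hm]
    linarith
  have hsup : (1 / m + 2 * μmax / m) * (|v₁ - v₂| + |a - b|)
      = (|v₁ - v₂| / m + μmax * (|a - b| / m)) + μmax * (|a - b| / m)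
        + (|a - b| / m + 2 * μmax / m * |v₁ - v₂|) := by ring
  have hx1 : 0 ≤ |a - b| / m + 2 * μmax / m * |v₁ - v₂| := by positivity
  have hlip : (1 + vmax / m) * (|v₁ - v₂| + |a - b|)
      = |v₁ - v₂| + vmax * (|a - b| / m) + (|a - b| + vmax / m * |v₁ - v₂|) := by ring
  have hx2 : 0 ≤ |a - b| + vmax / m * |v₁ - v₂| := by positivity
  unfold holNormIci
  rw [add_mul]
  apply add_le_add
  · apply Real.iSup_le _ (by positivity)
    rintro ⟨ρ, hρ⟩
    have hρ : 0 ≤ ρ := hρ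
    have k := key ρ hρ
    have hE : Real.exp (-a * ρ) ≤ 1 := by
      rw [Real.exp_le_one_iff]; nlinarith
    have hE0 := Real.exp_pos (-a * ρ)
    show |μ₁ * (1 - Real.exp (-a * ρ)) - μ₂ * (1 - Real.exp (-b * ρ))| ≤ _
    have : μ₁ * (1 - Real.exp (-a * ρ)) - μ₂ * (1 - Real.exp (-b * ρ))
      = (μ₁ - μ₂) * (1 - Real.exp (-a * ρ)) - μ₂ * (Real.exp (-a * ρ) - Real.exp (-b * ρ)) := by
      ring
    rw [this]
    refine (abs_sub _ _).trans ?_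
    rw [abs_mul, abs_mul, abs_of_pos hp2, abs_of_nonneg (by linarith : 0 ≤ 1 - Real.exp (-a * ρ))]
    have t1 : |μ₁ - μ₂| * (1 - Real.exp (-a * ρ)) ≤ |μ₁ - μ₂| :=
      mul_le_of_le_one_right (abs_nonneg _) (by linarith)
    have t2 : μ₂ * |Real.exp (-a * ρ) - Real.exp (-b * ρ)| ≤ μmax * (|a - b| / m) := by gcongr
    linarith
  · apply Real.iSup_le _ (by positivity)
    rintro ⟨⟨⟨ρ, hρ⟩, ⟨σ, hσ⟩⟩, hne⟩
    have hne : ρ ≠ σ := hne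
    rw [div_le_iff₀ (abs_pos.2 (sub_ne_zero.2 hne))]
    have hd : ∀ c w ν x : ℝ, w = ν * c → HasDerivAt (fun ρ => ν * (1 - Real.exp (-c * ρ)))
        (w * Real.exp (-c * x)) x := by
      intro c w ν x h
      have h1 : HasDerivAt (fun ρ : ℝ => -c * ρ) (-c) x := by
        simpa using (hasDerivAt_id x).const_mul (-c)
      have h2 := (h1.exp.const_sub 1).const_mul ν
      have h3 : w * Real.exp (-c * x) = ν * -(Real.exp (-c * x) * -c) := by rw [h]; ring
      rw [h3]
      exact h2
    have := (convex_Ici (0:ℝ)).norm_image_sub_le_of_norm_hasDerivWithin_le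
      (C := (1 + vmax / m) * (|v₁ - v₂| + |a - b|))
      (fun x _ => ((hd a v₁ μ₁ x e1).sub (hd b v₂ μ₂ x e2)).hasDerivWithinAt) ?_ hσ hρ
    · simpa only [Real.norm_eq_abs, Pi.sub_apply] using this
    · intro x hx
      have hx : 0 ≤ x := hx
      have k := key x hx
      have hE : Real.exp (-a * x) ≤ 1 := by
        rw [Real.exp_le_one_iff]; nlinarith
      have hE0 := Real.exp_pos (-a * x)
      have : v₁ * Real.exp (-a * x) - v₂ * Real.exp (-b * x) = (v₁ - v₂) * Real.exp (-a * x)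
        + v₂ * (Real.exp (-a * x) - Real.exp (-b * x)) := by ring
      rw [Real.norm_eq_abs, this]
      refine (abs_add_le _ _).trans ?_
      rw [abs_mul, abs_mul, abs_of_pos hw2, abs_of_pos hE0]
      have t1 : |v₁ - v₂| * Real.exp (-a * x) ≤ |v₁ - v₂| := mul_le_of_le_one_right hA hE
      have t2 : v₂ * |Real.exp (-a * x) - Real.exp (-b * x)| ≤ vmax * (|a - b| / m) := by gcongr
      linarith
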